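/- Let 1 ≤ m ≤ n, p > 1, p ≠ m, β ∈ ℝ, γ ≥ 0, and write points of ℝ^N = ℝ^n × ℝ^k as (x, y), z := (x₁,…,x_m). For every C¹ function u compactly supported in (ℝ^m\{0}) × ℝ^{N-m}, (|m+β|/p)^p ∫ |u|^p |z|^β dξ ≤ ∫ |∇_γ u|^p |z|^{p+β} dξ, where ∇_γ u = (∇_x u, |x|^γ ∇_y u) is the Grushin gradient. -/

import Mathlib

open Real MeasureTheory

lemma young_aux (p : ℝ) (hp : 1 < p) (c a b : ℝ) (hc : 0 ≤ c) (ha : 0 ≤ a) (hb : 0 ≤ b) :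
    c ^ (p - 1) * (a ^ (p - 1) * b) ≤ (1 - 1 / p) * (c ^ p * a ^ p) + b ^ p / p := by
  have hpq : p.HolderConjugate (p / (p - 1)) := Real.HolderConjugate.conjExponent hp
  have h := Real.young_inequality_of_nonneg hb (Real.rpow_nonneg (mul_nonneg hc ha) (p - 1)) hpq
  have hp1 : p - 1 ≠ 0 := by linarith
  have hp0 : p ≠ 0 := by linarith
  rw [← Real.rpow_mul (mul_nonneg hc ha), mul_div_cancel₀ _ hp1, Real.mul_rpow hc ha,
    Real.mul_rpow hc ha] at h
  have e : c ^ p * a ^ p / (p / (p - 1)) = (1 - 1 / p) * (c ^ p * a ^ p) := by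
    field_simp
  rw [e] at h
  linarith

section
variable {E : Type*} [NormedAddCommGroup E] [NormedSpace ℝ E] [FiniteDimensional ℝ E]
  [MeasurableSpace E] [BorelSpace E]

lemma ibp_aux (μ : Measure E) [μ.IsAddHaarMeasure] (m : ℕ) (L : Fin m → (E →L[ℝ] ℝ))
    (v : Fin m → E) (hLv : ∀ i, L i (v i) = 1) (ψ : E → ℝ) (hψ : ContDiff ℝ 1 ψ)
    (hc : HasCompactSupport ψ) :
    ∫ ξ, fderiv ℝ ψ ξ (∑ i, L i ξ • v i) ∂μ = -((m : ℝ) * ∫ ξ, ψ ξ ∂μ) := by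
  have hcont : ∀ i, Continuous (fun ξ => fderiv ℝ ψ ξ (v i)) := fun i =>
    (hψ.continuous_fderiv one_ne_zero).clm_apply continuous_const
  have hcs : ∀ i, HasCompactSupport (fun ξ => fderiv ℝ ψ ξ (v i)) := fun i =>
    hc.fderiv_apply ℝ (v i)
  have hint : ∀ i, Integrable (fun ξ => L i ξ * fderiv ℝ ψ ξ (v i)) μ := fun i =>
    ((L i).continuous.mul (hcont i)).integrable_of_hasCompactSupport (hcs i).mul_left
  have h1 : ∀ i, ∫ ξ, L i ξ * fderiv ℝ ψ ξ (v i) ∂μ = - ∫ ξ, ψ ξ ∂μ := by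
    intro i
    rw [integral_mul_fderiv_eq_neg_fderiv_mul_of_integrable]
    · simp [hLv]
    · simpa [hLv] using hψ.continuous.integrable_of_hasCompactSupport hc
    · exact hint i
    · exact ((L i).continuous.mul hψ.continuous).integrable_of_hasCompactSupport hc.mul_left
    · exact fun x _ => (L i).differentiableAt
    · exact fun x _ => hψ.differentiable one_ne_zero x
  simp only [map_sum, map_smul, smul_eq_mul]
  rw [integral_finsetSum _ (fun i _ => hint i)]
  simp [h1]

lemma hardy_aux (μ : Measure E) [μ.IsAddHaarMeasure] (m : ℕ) (L : Fin m → (E →L[ℝ] ℝ))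
    (v : Fin m → E) (hLv : ∀ i j, L i (v j) = if i = j then 1 else 0) (p β : ℝ) (hp : 1 < p)
    (u : E → ℝ) (hu : ContDiff ℝ 1 u) (hcs : HasCompactSupport u)
    (hsupp : ∀ ξ ∈ tsupport u, ∃ i, L i ξ ≠ 0)
    (G : E → ℝ) (hG : Continuous G) (hG0 : ∀ ξ, 0 ≤ G ξ) (hGs : ∀ ξ ∉ tsupport u, G ξ = 0)
    (hGu : ∀ ξ, |fderiv ℝ u ξ (∑ i, L i ξ • v i)| ≤ G ξ * √(∑ i, L i ξ ^ 2)) :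
    (|(m : ℝ) + β| / p) ^ p * ∫ ξ, |u ξ| ^ p * √(∑ i, L i ξ ^ 2) ^ β ∂μ ≤
      ∫ ξ, G ξ ^ p * √(∑ i, L i ξ ^ 2) ^ (p + β) ∂μ := by
  have hp0 : 0 < p := by linarith
  set w : E → ℝ := fun ξ => ∑ i, L i ξ ^ 2 with hw
  have hwpos : ∀ ξ ∈ tsupport u, 0 < w ξ := by
    intro ξ hξ
    obtain ⟨i, hi⟩ := hsupp ξ hξ
    exact Finset.sum_pos' (fun j _ => sq_nonneg _) ⟨i, Finset.mem_univ _, by positivity⟩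
  have hwC : ContDiff ℝ 1 w := by
    apply ContDiff.sum
    intro i _
    exact (L i).contDiff.pow 2
  set ψ : E → ℝ := fun ξ => |u ξ| ^ p * √(w ξ) ^ β with hψd
  set B : E → ℝ := fun ξ => G ξ ^ p * √(w ξ) ^ (p + β) with hBd
  set Z : E → E := fun ξ => ∑ i, L i ξ • v i with hZ
  have hu0 : ∀ ξ ∉ tsupport u, u ξ = 0 := fun ξ h => image_eq_zero_of_notMem_tsupport h
  have hψs : tsupport ψ ⊆ tsupport u := by
    apply closure_minimal _ (isClosed_tsupport u)
    intro ξ hξ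
    by_contra h
    exact hξ (by simp [hψd, hu0 ξ h, hp0.ne'])
  have hBs : tsupport B ⊆ tsupport u := by
    apply closure_minimal _ (isClosed_tsupport u)
    intro ξ hξ
    by_contra h
    exact hξ (by simp [hBd, hGs ξ h, hp0.ne'])
  have habs : ContDiff ℝ 1 (fun ξ => |u ξ| ^ p) := by
    have := (contDiff_norm_rpow (E := ℝ) hp).comp hu
    simpa [Function.comp_def] using this
  have hψC : ContDiff ℝ 1 ψ := by
    rw [contDiff_iff_contDiffAt]
    intro ξ
    by_cases hξ : ξ ∈ tsupport ψ
    swap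
    · exact (contDiffAt_const (c := (0 : ℝ))).congr_of_eventuallyEq
        (notMem_tsupport_iff_eventuallyEq.mp hξ)
    have h := hwpos ξ (hψs hξ)
    exact habs.contDiffAt.mul ((hwC.contDiffAt.sqrt h.ne').rpow_const_of_ne (Real.sqrt_pos.2 h).ne')
  have hψc : HasCompactSupport ψ := hcs.of_isClosed_subset (isClosed_tsupport _) hψs
  have hBC : Continuous B := by
    apply continuous_of_tsupport
    intro ξ hξ
    have h := hwpos ξ (hBs hξ)
    exact (hG.continuousAt.rpow_const (Or.inr hp0.le)).mul
      (hwC.continuous.continuousAt.sqrt.rpow_const (Or.inl (Real.sqrt_pos.2 h).ne'))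
  have hBc : HasCompactSupport B := hcs.of_isClosed_subset (isClosed_tsupport _) hBs
  have hψi : Integrable ψ μ := hψC.continuous.integrable_of_hasCompactSupport hψc
  have hBi : Integrable B μ := hBC.integrable_of_hasCompactSupport hBc
  have hZC : Continuous Z := by
    apply continuous_finsetSum
    intro i _
    exact (L i).continuous.smul continuous_const
  have hDi : Integrable (fun ξ => fderiv ℝ ψ ξ (Z ξ)) μ := by
    apply ((hψC.continuous_fderiv one_ne_zero).clm_apply hZC).integrable_of_hasCompactSupport
    apply (hψc.fderiv ℝ).mono
    intro ξ hξ h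
    exact hξ (by simp [h])
  have hibp := ibp_aux μ m L v (fun i => by simp [hLv]) ψ hψC hψc
  set T : E → ℝ := fun ξ => fderiv ℝ ψ ξ (Z ξ) - β * ψ ξ with hT
  have hTi : Integrable T μ := hDi.sub (hψi.const_mul β)
  have hTint : ∫ ξ, T ξ ∂μ = -((m + β) * ∫ ξ, ψ ξ ∂μ) := by
    rw [hT, integral_sub hDi (hψi.const_mul β), integral_const_mul, hibp]
    ring
  -- pointwise bound on T
  have hTb : ∀ ξ, |T ξ| ≤ p * (√(w ξ) ^ β * (|u ξ| ^ (p - 1) * (G ξ * √(w ξ)))) := by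
    intro ξ
    by_cases hξ : ξ ∈ tsupport u
    · have hwp := hwpos ξ hξ
      have hs := Real.sqrt_pos.2 hwp
      have hLZ : ∀ i, L i (Z ξ) = L i ξ := by
        intro i
        simp [hZ, hLv]
      have hdw : HasFDerivAt w (∑ i, (2 * L i ξ) • L i) ξ := by
        apply HasFDerivAt.fun_sum
        intro i _
        simpa using (L i).hasFDerivAt.pow 2
      have hdr := (hdw.sqrt hwp.ne').rpow_const (p := β) (Or.inl hs.ne')
      have hdu := (hasDerivAt_abs_rpow (u ξ) hp).comp_hasFDerivAt ξ
        (hu.differentiable one_ne_zero ξ).hasFDerivAt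
      have hd := hdu.mul hdr
      have hfd : fderiv ℝ ψ ξ = _ := hd.fderiv
      have hdwZ : (∑ i, (2 * L i ξ) • L i) (Z ξ) = 2 * w ξ := by
        simp [hLZ, hw, Finset.mul_sum]
        exact Finset.sum_congr rfl fun i _ => by ring
      have hTe : T ξ = √(w ξ) ^ β * ((p * |u ξ| ^ (p - 2) * u ξ) * fderiv ℝ u ξ (Z ξ)) := by
        change fderiv ℝ ψ ξ (Z ξ) - β * (|u ξ| ^ p * √(w ξ) ^ β) = _
        rw [hfd]
        simp only [add_apply, smul_apply, hdwZ, smul_eq_mul, Function.comp]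
        have e1 : √(w ξ) ^ (β - 1) = √(w ξ) ^ β / √(w ξ) := Real.rpow_sub_one hs.ne' β
        have e2 : w ξ = √(w ξ) * √(w ξ) := (Real.mul_self_sqrt hwp.le).symm
        rw [e1]
        have : 1 / (2 * √(w ξ)) * (2 * w ξ) = √(w ξ) := by
          rw [div_mul_eq_mul_div, div_eq_iff (by positivity)]
          linarith
        rw [this]
        field_simp
        ring
      have e3 : |u ξ| ^ (p - 2) * |u ξ| = |u ξ| ^ (p - 1) := by
        rw [← Real.rpow_add_one' (abs_nonneg _) (by linarith)]
        ring_nf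
      rw [hTe]
      simp only [abs_mul, abs_of_pos hp0, abs_of_nonneg (Real.rpow_nonneg (Real.sqrt_nonneg _) _),
        abs_of_nonneg (Real.rpow_nonneg (abs_nonneg _) _)]
      rw [mul_assoc p, e3]
      calc _ = p * (√(w ξ) ^ β * (|u ξ| ^ (p - 1) * |fderiv ℝ u ξ (Z ξ)|)) := by ring
        _ ≤ _ := by
          have := hGu ξ
          gcongr
    · have h1 : fderiv ℝ ψ ξ = 0 := fderiv_of_notMem_tsupport ℝ (fun h => hξ (hψs h))
      have h2 : ψ ξ = 0 := image_eq_zero_of_notMem_tsupport (fun h => hξ (hψs h))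
      simp [hT, h1, h2, hGs ξ hξ]
  set c := |(m : ℝ) + β| / p with hcd
  have hc0 : 0 ≤ c := by positivity
  have hpt : ∀ ξ, c ^ (p - 1) * (|T ξ| / p) ≤ (1 - 1 / p) * c ^ p * ψ ξ + B ξ / p := by
    intro ξ
    have hr := Real.sqrt_nonneg (w ξ)
    have hy := young_aux p hp c |u ξ| (G ξ * √(w ξ)) hc0 (abs_nonneg _) (mul_nonneg (hG0 ξ) hr)
    have h1 : |T ξ| / p ≤ √(w ξ) ^ β * (|u ξ| ^ (p - 1) * (G ξ * √(w ξ))) := by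
      rw [div_le_iff₀ hp0]; linarith [hTb ξ]
    have hBe : √(w ξ) ^ β * (G ξ * √(w ξ)) ^ p = B ξ := by
      by_cases hξ : ξ ∈ tsupport u
      · have hs := Real.sqrt_pos.2 (hwpos ξ hξ)
        simp only [hBd]
        rw [Real.mul_rpow (hG0 ξ) hr, Real.rpow_add hs]
        ring
      · simp [hBd, hGs ξ hξ, hp0.ne']
    calc _ ≤ c ^ (p - 1) * (√(w ξ) ^ β * (|u ξ| ^ (p - 1) * (G ξ * √(w ξ)))) := by gcongr
      _ = √(w ξ) ^ β * (c ^ (p - 1) * (|u ξ| ^ (p - 1) * (G ξ * √(w ξ)))) := by ring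
      _ ≤ √(w ξ) ^ β * ((1 - 1 / p) * (c ^ p * |u ξ| ^ p) + (G ξ * √(w ξ)) ^ p / p) := by gcongr
      _ = _ := by rw [← hBe]; simp only [hψd]; ring
  have hmono := integral_mono ((hTi.abs.div_const p).const_mul (c ^ (p - 1)))
    ((hψi.const_mul ((1 - 1 / p) * c ^ p)).add (hBi.div_const p)) hpt
  have hA0 : 0 ≤ ∫ ξ, ψ ξ ∂μ := integral_nonneg fun ξ => by positivity
  have e4 := integral_add (hψi.const_mul ((1 - 1 / p) * c ^ p)) (hBi.div_const p)
  simp only [Pi.add_apply] at hmono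
  rw [e4, integral_const_mul, integral_const_mul, integral_div, integral_div] at hmono
  have habsT : |(m : ℝ) + β| * ∫ ξ, ψ ξ ∂μ ≤ ∫ ξ, |T ξ| ∂μ := by
    have := abs_integral_le_integral_abs (f := T) (μ := μ)
    rwa [hTint, abs_neg, abs_mul, abs_of_nonneg hA0] at this
  have h5 : c * ∫ ξ, ψ ξ ∂μ ≤ (∫ ξ, |T ξ| ∂μ) / p := by
    rw [le_div_iff₀ hp0, hcd]
    calc _ = |(m : ℝ) + β| * ∫ ξ, ψ ξ ∂μ := by field_simp
      _ ≤ _ := habsT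
  have h6 : c ^ p = c ^ (p - 1) * c := by
    rw [← Real.rpow_add_one' hc0 (by linarith)]; ring_nf
  have h7 : c ^ p * ∫ ξ, ψ ξ ∂μ ≤ c ^ (p - 1) * ((∫ ξ, |T ξ| ∂μ) / p) := by
    rw [h6, mul_assoc]; gcongr
  have h8 := h7.trans hmono
  have h9 : (1 / p) * (c ^ p * ∫ ξ, ψ ξ ∂μ) ≤ (1 / p) * ∫ ξ, B ξ ∂μ := by
    linarith [h8, div_eq_mul_one_div (∫ ξ, B ξ ∂μ) p]
  exact le_of_mul_le_mul_left h9 (by positivity)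
end

theorem stmt15 (n k m : ℕ) (hm1 : 1 ≤ m) (hmn : m ≤ n) (p β γ : ℝ) (hp : 1 < p)
    (hpm : p ≠ (m : ℝ)) (hγ : 0 ≤ γ)
    (u : EuclideanSpace ℝ (Fin n) × EuclideanSpace ℝ (Fin k) → ℝ)
    (hu : ContDiff ℝ 1 u) (hcs : HasCompactSupport u)
    (hsupp : ∀ ξ ∈ tsupport u, ∃ i : Fin m, ξ.1 (Fin.castLE hmn i) ≠ 0) :
    (|(m : ℝ) + β| / p) ^ p *
        ∫ ξ : EuclideanSpace ℝ (Fin n) × EuclideanSpace ℝ (Fin k),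
          |u ξ| ^ p * Real.sqrt (∑ i : Fin m, ξ.1 (Fin.castLE hmn i) ^ 2) ^ β ≤
      ∫ ξ : EuclideanSpace ℝ (Fin n) × EuclideanSpace ℝ (Fin k),
        Real.sqrt (‖gradient (fun x' => u (x', ξ.2)) ξ.1‖ ^ 2 +
            ‖ξ.1‖ ^ (2 * γ) * ‖gradient (fun y' => u (ξ.1, y')) ξ.2‖ ^ 2) ^ p *
          Real.sqrt (∑ i : Fin m, ξ.1 (Fin.castLE hmn i) ^ 2) ^ (p + β) := by
  have hud : Differentiable ℝ u := hu.differentiable one_ne_zero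
  have hp0 : 0 < p := by linarith
  have hfx : ∀ ξ : EuclideanSpace ℝ (Fin n) × EuclideanSpace ℝ (Fin k),
      fderiv ℝ (fun x' => u (x', ξ.2)) ξ.1 =
        (fderiv ℝ u ξ).comp (ContinuousLinearMap.inl ℝ _ _) := by
    intro ξ
    exact (HasFDerivAt.comp ξ.1 (hud ξ).hasFDerivAt (hasFDerivAt_prodMk_left ξ.1 ξ.2)).fderiv
  have hfy : ∀ ξ : EuclideanSpace ℝ (Fin n) × EuclideanSpace ℝ (Fin k),
      fderiv ℝ (fun y' => u (ξ.1, y')) ξ.2 =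
        (fderiv ℝ u ξ).comp (ContinuousLinearMap.inr ℝ _ _) := by
    intro ξ
    exact (HasFDerivAt.comp ξ.2 (hud ξ).hasFDerivAt (hasFDerivAt_prodMk_right ξ.1 ξ.2)).fderiv
  have hgx : ∀ ξ : EuclideanSpace ℝ (Fin n) × EuclideanSpace ℝ (Fin k),
      ‖gradient (fun x' => u (x', ξ.2)) ξ.1‖ =
        ‖(fderiv ℝ u ξ).comp (ContinuousLinearMap.inl ℝ _ _)‖ := by
    intro ξ
    rw [gradient, LinearIsometryEquiv.norm_map, hfx]
  have hgy : ∀ ξ : EuclideanSpace ℝ (Fin n) × EuclideanSpace ℝ (Fin k),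
      ‖gradient (fun y' => u (ξ.1, y')) ξ.2‖ =
        ‖(fderiv ℝ u ξ).comp (ContinuousLinearMap.inr ℝ _ _)‖ := by
    intro ξ
    rw [gradient, LinearIsometryEquiv.norm_map, hfy]
  have hcf : Continuous (fderiv ℝ u) := hu.continuous_fderiv one_ne_zero
  simp only [hgx, hgy]
  haveI : (volume : Measure (EuclideanSpace ℝ (Fin n) ×
      EuclideanSpace ℝ (Fin k))).IsAddHaarMeasure := by
    rw [Measure.volume_eq_prod]
    infer_instance
  refine hardy_aux (E := EuclideanSpace ℝ (Fin n) × EuclideanSpace ℝ (Fin k)) volume m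
    (fun i => (EuclideanSpace.proj (Fin.castLE hmn i) : EuclideanSpace ℝ (Fin n) →L[ℝ] ℝ).comp
      (ContinuousLinearMap.fst ℝ (EuclideanSpace ℝ (Fin n)) (EuclideanSpace ℝ (Fin k))))
    (fun i => (EuclideanSpace.single (Fin.castLE hmn i) 1, 0)) ?_ p β hp u hu hcs hsupp
    (fun ξ => √(‖(fderiv ℝ u ξ).comp (ContinuousLinearMap.inl ℝ _ _)‖ ^ 2 +
      ‖ξ.1‖ ^ (2 * γ) * ‖(fderiv ℝ u ξ).comp (ContinuousLinearMap.inr ℝ _ _)‖ ^ 2))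
    ?_ (fun ξ => Real.sqrt_nonneg _) ?_ ?_
  · intro i j
    simp [PiLp.single_apply, Fin.ext_iff]
  · refine Continuous.sqrt (Continuous.add ?_ (Continuous.mul ?_ ?_))
    · exact ((hcf.clm_comp continuous_const).norm).pow 2
    · exact continuous_fst.norm.rpow_const fun _ => Or.inr (by linarith)
    · exact ((hcf.clm_comp continuous_const).norm).pow 2
  · intro ξ hξ
    have : fderiv ℝ u ξ = 0 := fderiv_of_notMem_tsupport ℝ hξ
    simp [this]
  · intro ξ
    set Z : EuclideanSpace ℝ (Fin n) :=
      ∑ i : Fin m, ξ.1 (Fin.castLE hmn i) • EuclideanSpace.single (Fin.castLE hmn i) (1 : ℝ) with hZ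
    have hZn : ‖Z‖ = √(∑ i : Fin m, ξ.1 (Fin.castLE hmn i) ^ 2) := by
      have ho := (EuclideanSpace.orthonormal_single (𝕜 := ℝ) (ι := Fin n)).comp
        (Fin.castLE hmn) (Fin.castLE_injective hmn)
      have := ho.inner_sum (fun i => ξ.1 (Fin.castLE hmn i)) (fun i => ξ.1 (Fin.castLE hmn i))
        Finset.univ
      rw [norm_eq_sqrt_real_inner]
      congr 1
      refine this.trans (Finset.sum_congr rfl fun i _ => ?_)
      simp [sq]
    have he : (∑ i : Fin m, (ξ.1 (Fin.castLE hmn i)) •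
        ((EuclideanSpace.single (Fin.castLE hmn i) (1 : ℝ), 0) :
          EuclideanSpace ℝ (Fin n) × EuclideanSpace ℝ (Fin k))) =
        ContinuousLinearMap.inl ℝ _ _ Z := by
      rw [hZ, map_sum]
      refine Finset.sum_congr rfl fun i _ => ?_
      rw [map_smul]; rfl
    change |fderiv ℝ u ξ (∑ i : Fin m, (ξ.1 (Fin.castLE hmn i)) •
        ((EuclideanSpace.single (Fin.castLE hmn i) (1 : ℝ), 0) :
          EuclideanSpace ℝ (Fin n) × EuclideanSpace ℝ (Fin k)))| ≤
        _ * √(∑ i : Fin m, ξ.1 (Fin.castLE hmn i) ^ 2)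
    rw [he, ← hZn]
    have h1 := ((fderiv ℝ u ξ).comp (ContinuousLinearMap.inl ℝ (EuclideanSpace ℝ (Fin n))
      (EuclideanSpace ℝ (Fin k)))).le_opNorm Z
    refine h1.trans ?_
    gcongr
    apply Real.le_sqrt_of_sq_le
    have : 0 ≤ ‖ξ.1‖ ^ (2 * γ) := Real.rpow_nonneg (norm_nonneg _) _
    nlinarith [mul_nonneg this (sq_nonneg ‖(fderiv ℝ u ξ).comp (ContinuousLinearMap.inr ℝ
      (EuclideanSpace ℝ (Fin n)) (EuclideanSpace ℝ (Fin k)))‖)]
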